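/- Let a_1,…,a_n ∈ ℝ^{d} be linearly independent, let λ_1,…,λ_n, η_1,…,η_n, C ∈ ℝ, and let ℓ : ℝ^{d} → ℝ be an affine function. Suppose that for all z ∈ ℝ^{d}: ( Σ_j λ_j ⟨a_j, z⟩ + C )² = Σ_j η_j ⟨a_j, z⟩² + ℓ(z). Then at most one of the coefficients λ_1,…,λ_n is nonzero. -/

import Mathlib

open Matrix

/-- A linearly independent family in `Fin d → K` admits a dual family
with respect to the dot product. -/
theorem LinearIndependent.exists_dotProduct_eq_ite {K ι : Type*} [Field K]
    [DecidableEq ι] {d : ℕ} {a : ι → Fin d → K} (ha : LinearIndependent K a) (i : ι) :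
    ∃ z : Fin d → K, ∀ k, a k ⬝ᵥ z = if k = i then 1 else 0 := by
  obtain ⟨g, hg⟩ := LinearMap.exists_leftInverse_of_injective (Finsupp.linearCombination K a)
    (LinearMap.ker_eq_bot.2 ha)
  have hga : ∀ k, g (a k) = Finsupp.single k 1 := fun k => by
    simpa using LinearMap.congr_fun hg (Finsupp.single k 1)
  refine ⟨fun m => g (Pi.single m 1) i, fun k => ?_⟩
  have hk : Finsupp.lapply (R := K) i (g (a k)) = a k ⬝ᵥ fun m => g (Pi.single m 1) i := by
    conv_lhs => rw [pi_eq_sum_univ' (a k)]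
    simp [dotProduct]
  rw [← hk, hga]
  simp [Finsupp.single_apply]

/-- if the square of the affine form `Σ_j λ_j ⟨a_j,z⟩ + C` equals a
diagonal quadratic form `Σ_j η_j ⟨a_j,z⟩²` plus an affine function `ℓ(z) = ⟨u,z⟩ + c₀`
for linearly independent `a_j`, then at most one coefficient `λ_j` is nonzero. -/
theorem disentangling_at_most_one_nonzero
    {d n : ℕ} (a : Fin n → Fin d → ℝ) (ha : LinearIndependent ℝ a)
    (lam η : Fin n → ℝ) (C : ℝ) (u : Fin d → ℝ) (c₀ : ℝ)
    (h : ∀ z : Fin d → ℝ,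
      (∑ j, lam j * (a j ⬝ᵥ z) + C) ^ 2
        = ∑ j, η j * (a j ⬝ᵥ z) ^ 2 + (u ⬝ᵥ z + c₀)) :
    ∀ i j, lam i ≠ 0 → lam j ≠ 0 → i = j := by
  intro i j hi hj
  by_contra hij
  obtain ⟨x, hx⟩ := ha.exists_dotProduct_eq_ite i
  obtain ⟨y, hy⟩ := ha.exists_dotProduct_eq_ite j
  have hmixed : ∑ k, η k * (a k ⬝ᵥ (x + y)) ^ 2
      = ∑ k, η k * (a k ⬝ᵥ x) ^ 2 + ∑ k, η k * (a k ⬝ᵥ y) ^ 2 := by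
    rw [← Finset.sum_add_distrib]
    refine Finset.sum_congr rfl fun k _ => ?_
    rw [dotProduct_add, hx, hy]
    split_ifs with hki hkj
    · exact absurd (hki.symm.trans hkj) hij
    all_goals ring
  have h0 := h 0
  have h1 := h x
  have h2 := h y
  have h3 := h (x + y)
  rw [hmixed] at h3
  simp only [dotProduct_add, mul_add, Finset.sum_add_distrib] at h3
  have hlx : ∑ k, lam k * (a k ⬝ᵥ x) = lam i := by simp [hx]
  have hly : ∑ k, lam k * (a k ⬝ᵥ y) = lam j := by simp [hy]
  rw [hlx] at h1 h3
  rw [hly] at h2 h3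
  simp only [dotProduct_zero, mul_zero, Finset.sum_const_zero, zero_add, ne_eq,
    OfNat.ofNat_ne_zero, not_false_eq_true, zero_pow] at h0
  exact mul_ne_zero hi hj (by linarith)
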